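/- Let a, b, c ∈ ℝ with c > 0 and let z ∈ (0,1). Then the function w ↦ w^{b−1} · F(a,b−1;c;w) (real power w^{b−1}) has derivative at z equal to (b−1) · z^{b−2} · F(a,b;c;z). -/

import Mathlib

/-- The rising factorial (Pochhammer symbol) `(x)_j = x(x+1)⋯(x+j-1)`. -/
noncomputable def risingFactorial (j : ℕ) (x : ℝ) : ℝ := (ascPochhammer ℝ j).eval x

/-- The Gauss hypergeometric function `F(a,b;c;z) = ∑_{j=0}^∞ ((a)_j (b)_j/((c)_j j!)) z^j`. -/
noncomputable def hypF (a b c z : ℝ) : ℝ :=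
  ∑' j : ℕ, risingFactorial j a * risingFactorial j b
    / (risingFactorial j c * (Nat.factorial j : ℝ)) * z ^ j

lemma risingFactorial_succ (j : ℕ) (x : ℝ) :
    risingFactorial (j + 1) x = risingFactorial j x * (x + j) := by
  simp [risingFactorial, ascPochhammer_succ_eval]

lemma risingFactorial_succ_left (j : ℕ) (x : ℝ) :
    risingFactorial (j + 1) x = x * risingFactorial j (x + 1) := by
  simp [risingFactorial, ascPochhammer_succ_left]

lemma risingFactorial_pos (j : ℕ) {x : ℝ} (hx : 0 < x) : 0 < risingFactorial j x :=
  ascPochhammer_pos j x hx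

/-- The `j`-th coefficient of the Gauss hypergeometric series. -/
noncomputable def hypCoeff (a b c : ℝ) (j : ℕ) : ℝ :=
  risingFactorial j a * risingFactorial j b / (risingFactorial j c * (Nat.factorial j : ℝ))

lemma hypCoeff_succ (a b : ℝ) {c : ℝ} (hc : 0 < c) (j : ℕ) :
    hypCoeff a b c (j + 1) = hypCoeff a b c j * ((a + j) / (1 + j) * ((b + j) / (c + j))) := by
  have h1 := (risingFactorial_pos j hc).ne'
  have h2 : (Nat.factorial j : ℝ) ≠ 0 := by positivity
  have h3 : c + (j : ℝ) ≠ 0 := by positivity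
  have h4 : (1 : ℝ) + j ≠ 0 := by positivity
  have h5 : (j : ℝ) + 1 ≠ 0 := by positivity
  simp only [hypCoeff, risingFactorial_succ, Nat.factorial_succ]
  push_cast
  field_simp
  ring

lemma add_mul_hypCoeff (a b c : ℝ) (j : ℕ) :
    (b - 1 + j) * hypCoeff a (b - 1) c j = (b - 1) * hypCoeff a b c j := by
  have h : risingFactorial j (b - 1) * (b - 1 + j) = (b - 1) * risingFactorial j b := by
    rw [← risingFactorial_succ, risingFactorial_succ_left, sub_add_cancel]
  simp only [hypCoeff]
  linear_combination
    (risingFactorial j a / (risingFactorial j c * (Nat.factorial j : ℝ))) * h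

lemma tendsto_add_natCast_div_add_natCast (x y : ℝ) :
    Filter.Tendsto (fun j : ℕ => (x + j) / (y + j)) Filter.atTop (nhds 1) := by
  simpa using tendsto_add_mul_div_add_mul_atTop_nhds x y 1 (one_ne_zero (α := ℝ))

lemma summable_succ_mul_hypCoeff_mul_pow (a b : ℝ) {c r : ℝ} (hc : 0 < c)
    (hr : 0 < r) (hr1 : r < 1) :
    Summable (fun j : ℕ => ((1 : ℝ) + j) * hypCoeff a b c j * r ^ j) := by
  have hlim : Filter.Tendsto (fun j : ℕ => ‖((2 : ℝ) + j) / (1 + j) *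
      ((a + j) / (1 + j) * ((b + j) / (c + j))) * r‖) Filter.atTop (nhds r) := by
    have h := (((tendsto_add_natCast_div_add_natCast 2 1).mul
      ((tendsto_add_natCast_div_add_natCast a 1).mul
        (tendsto_add_natCast_div_add_natCast b c))).mul_const r).norm
    simpa [abs_of_pos hr] using h
  obtain ⟨s, hrs, hs⟩ := exists_between hr1
  refine summable_of_ratio_norm_eventually_le hs ?_
  filter_upwards [hlim.eventually_le_const hrs] with j hj
  have h4 : (1 : ℝ) + j ≠ 0 := by positivity
  have key : ((1 : ℝ) + (j + 1 : ℕ)) * hypCoeff a b c (j + 1) * r ^ (j + 1) =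
      (((2 : ℝ) + j) / (1 + j) * ((a + j) / (1 + j) * ((b + j) / (c + j))) * r) *
        ((1 + j) * hypCoeff a b c j * r ^ j) := by
    rw [hypCoeff_succ a b hc]
    generalize (b + j) / (c + j) = q
    push_cast
    field_simp
    ring
  rw [key, norm_mul]
  exact mul_le_mul_of_nonneg_right hj (norm_nonneg _)

lemma summable_hypCoeff_mul_pow (a b : ℝ) {c r : ℝ} (hc : 0 < c)
    (hr : 0 < r) (hr1 : r < 1) : Summable (fun j : ℕ => hypCoeff a b c j * r ^ j) := by
  refine .of_norm_bounded (summable_succ_mul_hypCoeff_mul_pow a b hc hr hr1).norm fun j => ?_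
  rw [mul_assoc, norm_mul (1 + (j : ℝ))]
  refine le_mul_of_one_le_left (norm_nonneg _) ?_
  rw [Real.norm_of_nonneg (by positivity)]
  simp

lemma summable_natCast_mul_hypCoeff_mul_pow (a b : ℝ) {c r : ℝ} (hc : 0 < c)
    (hr : 0 < r) (hr1 : r < 1) :
    Summable (fun j : ℕ => (j : ℝ) * hypCoeff a b c j * r ^ j) := by
  refine ((summable_succ_mul_hypCoeff_mul_pow a b hc hr hr1).sub
    (summable_hypCoeff_mul_pow a b hc hr hr1)).congr fun j => ?_
  ring

lemma hasDerivAt_hypF (a b : ℝ) {c z : ℝ} (hc : 0 < c) (hz : z ∈ Set.Ioo (0 : ℝ) 1) :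
    HasDerivAt (hypF a b c) (∑' j : ℕ, hypCoeff a b c j * (j * z ^ (j - 1))) z := by
  obtain ⟨r, hzr, hr1⟩ := exists_between hz.2
  have hr : 0 < r := hz.1.trans hzr
  have hu : Summable (fun j : ℕ => ‖(j : ℝ) * hypCoeff a b c j * r ^ j‖ * r⁻¹) :=
    (summable_natCast_mul_hypCoeff_mul_pow a b hc hr hr1).norm.mul_right _
  refine hasDerivAt_tsum_of_isPreconnected
    (g := fun (j : ℕ) w => hypCoeff a b c j * w ^ j)
    (g' := fun (j : ℕ) w => hypCoeff a b c j * (j * w ^ (j - 1))) hu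
    isOpen_Ioo (isPreconnected_Ioo (a := (0 : ℝ)) (b := r))
    (fun j w _ => (hasDerivAt_pow j w).const_mul _) (fun j w hw => ?_) ⟨hz.1, hzr⟩
    (summable_hypCoeff_mul_pow a b hc hz.1 hz.2) ⟨hz.1, hzr⟩
  rcases j with _ | j
  · simp
  · have h : w ^ j ≤ r ^ j := pow_le_pow_left₀ hw.1.le hw.2.le j
    simp only [norm_mul, norm_pow, Real.norm_of_nonneg hw.1.le, Real.norm_of_nonneg hr.le,
      Nat.add_sub_cancel]
    have e : ‖((j + 1 : ℕ) : ℝ)‖ * ‖hypCoeff a b c (j + 1)‖ * r ^ (j + 1) * r⁻¹ =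
        ‖hypCoeff a b c (j + 1)‖ * (‖((j + 1 : ℕ) : ℝ)‖ * r ^ j) := by
      field_simp
      ring
    rw [e]
    gcongr

/-- Derivative formula
`(d/dz)[z^{b-1} F(a,b-1;c;z)] = (b-1) z^{b-2} F(a,b;c;z)` for `c > 0` and `z ∈ (0,1)`,
with real powers. -/
theorem hypergeometric_weighted_deriv_b
    (a b c : ℝ) (hc : 0 < c) (z : ℝ) (hz : z ∈ Set.Ioo (0:ℝ) 1) :
    HasDerivAt (fun w : ℝ => w ^ (b - 1) * hypF a (b - 1) c w)
      ((b - 1) * z ^ (b - 2) * hypF a b c z) z := by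
  obtain ⟨hz0, hz1⟩ := hz
  have hpow : HasDerivAt (fun w : ℝ => w ^ (b - 1)) ((b - 1) * z ^ (b - 2)) z := by
    convert Real.hasDerivAt_rpow_const (p := b - 1) (Or.inl hz0.ne') using 3
    ring
  have hz2 : z ^ (b - 1) = z ^ (b - 2) * z := by
    rw [← Real.rpow_add_one hz0.ne']
    congr 1
    ring
  have hderiv : z * ∑' j : ℕ, hypCoeff a (b - 1) c j * (j * z ^ (j - 1)) =
      ∑' j : ℕ, (j : ℝ) * hypCoeff a (b - 1) c j * z ^ j := by
    rw [← tsum_mul_left]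
    refine tsum_congr fun j => ?_
    rcases j with _ | j
    · simp
    · rw [Nat.add_sub_cancel, pow_succ]
      ring
  have hsum : (b - 1) * hypF a (b - 1) c z +
      z * ∑' j : ℕ, hypCoeff a (b - 1) c j * (j * z ^ (j - 1)) = (b - 1) * hypF a b c z := by
    change (b - 1) * ∑' j : ℕ, hypCoeff a (b - 1) c j * z ^ j + _ =
      (b - 1) * ∑' j : ℕ, hypCoeff a b c j * z ^ j
    rw [hderiv, ← tsum_mul_left, ← tsum_mul_left,
      ← ((summable_hypCoeff_mul_pow a (b - 1) hc hz0 hz1).mul_left (b - 1)).tsum_add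
        (summable_natCast_mul_hypCoeff_mul_pow a (b - 1) hc hz0 hz1)]
    refine tsum_congr fun j => ?_
    linear_combination z ^ j * add_mul_hypCoeff a b c j
  refine (hpow.mul (hasDerivAt_hypF a (b - 1) hc ⟨hz0, hz1⟩)).congr_deriv ?_
  rw [hz2]
  linear_combination z ^ (b - 2) * hsum
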